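/- arXiv:0712.0165 — 4 statements merged into one kernel-verified Lean document; each statement's English description precedes it below -/
import Mathlib

section
/- The coding map h is continuous and injective. -/
universe u

/-- We equip `Option σ` (the alphabet `Γ = Σ ∪ {A}`, with `A = none`) with the
discrete topology. -/
instance instTopOption (σ : Type u) : TopologicalSpace (Option σ) := ⊥
instance instDiscreteOption (σ : Type u) : DiscreteTopology (Option σ) := ⟨rfl⟩

/-- Auxiliary function for the coding map `h`: reads position `i` inside the
concatenation of the blocks `A·0^(n+1)·x(n), A·0^(n+2)·x(n+1), ...`. -/
def hAux {σ : Type u} (z : σ) (x : ℕ → σ) : ℕ → ℕ → Option σ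
  | _, 0 => none
  | n, (i+1) =>
    if i + 1 ≤ n + 1 then some z
    else if i + 1 = n + 2 then some (x n)
    else hAux z x (n+1) (i + 1 - (n+3))
  termination_by n i => i
  decreasing_by omega

/-- The coding map `h : Σ^ω → Γ^ω`,
`h(x) = A·0·x(1)·A·0²·x(2)·A·0³·x(3)···A·0ⁿ·x(n)···` (ω-words indexed by `ℕ`). -/
def hmap {σ : Type u} (z : σ) (x : ℕ → σ) : ℕ → Option σ := fun i => hAux z x 0 i

/-- Auxiliary function for the ω-word `α₀`. -/
def aAux {σ : Type u} (z : σ) : ℕ → ℕ → Option σ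
  | _, 0 => none
  | n, (i+1) =>
    if i + 1 ≤ n + 1 then some z
    else aAux z (n+1) (i + 1 - (n+2))
  termination_by n i => i
  decreasing_by omega

/-- The ω-word `α₀ = A·0·A·0²·A·0³···A·0ⁿ···` over `Γ = Σ ∪ {A}`. -/
def alphaWord {σ : Type u} (z : σ) : ℕ → Option σ := fun i => aAux z 0 i

/-- The Borel hierarchy on a topological space `X`: `SigmaPi X α true` is the class
`Σ⁰_α` and `SigmaPi X α false` is the class `Π⁰_α`.  `Σ⁰_1` is the class of open
sets, `Π⁰_1` is the class of closed sets, and for `α ≥ 2`, `Σ⁰_α` (resp. `Π⁰_α`)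
is the class of countable unions (resp. intersections) of sets in
`⋃_{γ < α} Π⁰_γ` (resp. `⋃_{γ < α} Σ⁰_γ`). -/
def SigmaPi (X : Type u) [TopologicalSpace X] (α : Ordinal.{0}) (b : Bool) : Set (Set X) :=
  {s | (α = 1 ∧ ((b = true ∧ IsOpen s) ∨ (b = false ∧ IsClosed s)))
    ∨ (α ≠ 1 ∧ ∃ f : ℕ → Set X,
        (∀ n : ℕ, ∃ γ : Ordinal.{0}, ∃ _ : γ < α, f n ∈ SigmaPi X γ !b) ∧
        s = if b then ⋃ n, f n else ⋂ n, f n)}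
  termination_by α
  decreasing_by assumption

/-- The class `Σ⁰_α` of the Borel hierarchy on `X`. -/
abbrev Sigma0 (X : Type u) [TopologicalSpace X] (α : Ordinal.{0}) : Set (Set X) :=
  SigmaPi X α true

/-- The class `Π⁰_α` of the Borel hierarchy on `X`. -/
abbrev Pi0 (X : Type u) [TopologicalSpace X] (α : Ordinal.{0}) : Set (Set X) :=
  SigmaPi X α false

/-- `F ⊆ Σ^ω` is `Σ⁰_α`-complete (for `b = true`), resp. `Π⁰_α`-complete (for
`b = false`), iff for every nonempty finite alphabet `Y` and every `E ⊆ Y^ω`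
(with `Y^ω` carrying the Cantor topology, i.e. the product of the discrete
topology): `E ∈ Σ⁰_α` (resp. `Π⁰_α`) iff `E = f⁻¹(F)` for some continuous
`f : Y^ω → Σ^ω`. -/
def IsCompleteFor (b : Bool) (α : Ordinal.{0}) {σ : Type} [TopologicalSpace σ]
    (F : Set (ℕ → σ)) : Prop :=
  ∀ (Y : Type), Fintype Y → Nonempty Y → ∀ E : Set (ℕ → Y),
    letI : TopologicalSpace Y := ⊥
    (E ∈ SigmaPi (ℕ → Y) α b ↔
      ∃ f : (ℕ → Y) → (ℕ → σ), Continuous f ∧ E = f ⁻¹' F)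

/-- The infinite concatenation of the finite words `u 0, u 1, u 2, ...` equals the
ω-word `x`: every finite partial concatenation is a prefix of `x`, and the total
length is infinite. -/
def JoinsTo {α : Type u} (u : ℕ → List α) (x : ℕ → α) : Prop :=
  (∀ N : ℕ, ∃ n : ℕ, N ≤ (((List.range n).map u).flatten).length) ∧
  (∀ (n i : ℕ) (h : i < (((List.range n).map u).flatten).length),
      (((List.range n).map u).flatten)[i]'h = x i)

/-- A 2-tape Büchi automaton with input alphabet `σ` and output alphabet `γ`:
a finite set of states `Q`, a finite set `trans ⊆ Q × σ^⋆ × γ^⋆ × Q` of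
transitions, an initial state `init` and a set `acc` of accepting states. -/
structure TwoTapeBuchi (σ γ : Type u) where
  Q : Type u
  finQ : Finite Q
  trans : Set (Q × List σ × List γ × Q)
  finTrans : trans.Finite
  init : Q
  acc : Set Q

/-- The pair `(x, y)` of ω-words is accepted by the 2-tape Büchi automaton `T`
iff it is the pair of input and output words of some successful computation. -/
def TwoTapeBuchi.Accepts {σ γ : Type u} (T : TwoTapeBuchi σ γ)
    (x : ℕ → σ) (y : ℕ → γ) : Prop :=
  ∃ (q : ℕ → T.Q) (u : ℕ → List σ) (v : ℕ → List γ),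
    q 0 = T.init ∧
    (∀ n : ℕ, (q n, u n, v n, q (n+1)) ∈ T.trans) ∧
    (∃ qf ∈ T.acc, ∀ n : ℕ, ∃ m : ℕ, n ≤ m ∧ q m = qf) ∧
    JoinsTo u x ∧ JoinsTo v y

/-- `R ⊆ Σ^ω × Γ^ω` is an infinitary rational relation iff it is the relation
accepted by some 2-tape Büchi automaton. -/
def IsRatRel {σ γ : Type u} (R : Set ((ℕ → σ) × (ℕ → γ))) : Prop :=
  ∃ T : TwoTapeBuchi σ γ, ∀ p : (ℕ → σ) × (ℕ → γ), p ∈ R ↔ T.Accepts p.1 p.2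

/-- A real-time Büchi 1-counter automaton: transitions are in
`Q × σ × Bool × Q × ℤ` with the counter move in `{-1, 0, 1}`, and a zero test
(`false` means the counter is zero) which forbids decrementing a zero counter. -/
structure OneCounterBuchi (σ : Type u) where
  Q : Type u
  finQ : Finite Q
  trans : Set (Q × σ × Bool × Q × ℤ)
  transMoves : ∀ t ∈ trans, t.2.2.2.2 = -1 ∨ t.2.2.2.2 = 0 ∨ t.2.2.2.2 = 1
  transZero : ∀ t ∈ trans, t.2.2.1 = false → t.2.2.2.2 = 0 ∨ t.2.2.2.2 = 1
  init : Q
  acc : Set Q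

/-- One computation step of a 1-counter automaton on letter `a`, from
configuration `p` to configuration `p'`. -/
def OneCounterBuchi.Step {σ : Type u} (M : OneCounterBuchi σ) (a : σ)
    (p p' : M.Q × ℕ) : Prop :=
  ∃ j : ℤ, (p.1, a, (p.2 ≠ 0 : Bool), p'.1, j) ∈ M.trans ∧ (p'.2 : ℤ) = (p.2 : ℤ) + j

/-- The ω-word `x` is accepted by the real-time Büchi 1-counter automaton `M`:
there is a run on `x` starting in `(q₀, 0)` in which some accepting state occurs
infinitely often. -/
def OneCounterBuchi.Accepts {σ : Type u} (M : OneCounterBuchi σ) (x : ℕ → σ) : Prop :=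
  ∃ r : ℕ → M.Q × ℕ,
    r 0 = (M.init, 0) ∧
    (∀ i : ℕ, M.Step (x i) (r i) (r (i+1))) ∧
    ∃ qf ∈ M.acc, ∀ n : ℕ, ∃ m : ℕ, n ≤ m ∧ (r m).1 = qf

/-- The identification of a pair of ω-words with an ω-word over the product
alphabet. -/
def pairToWord {a b : Type u} (p : (ℕ → a) × (ℕ → b)) : ℕ → a × b :=
  fun n => (p.1 n, p.2 n)
theorem hAux_continuous {σ : Type} [TopologicalSpace σ] [DiscreteTopology σ] (z : σ) (i : ℕ) :
    ∀ n : ℕ, Continuous (fun x : ℕ → σ => hAux z x n i) := by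
  induction i using Nat.strong_induction_on with
  | _ i ih =>
    intro n
    cases i with
    | zero => simp only [hAux]; exact continuous_const
    | succ i =>
      by_cases h1 : i + 1 ≤ n + 1
      · have : (fun x : ℕ → σ => hAux z x n (i+1)) = fun _ => some z := by
          funext x; rw [hAux, if_pos h1]
        rw [this]; exact continuous_const
      · by_cases h2 : i + 1 = n + 2
        · have : (fun x : ℕ → σ => hAux z x n (i+1)) = fun x => some (x n) := by
            funext x; rw [hAux, if_neg h1, if_pos h2]
          rw [this]
          exact (continuous_of_discreteTopology (f := fun a : σ => some a)).comp
            (continuous_apply n)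
        · have : (fun x : ℕ → σ => hAux z x n (i+1)) =
              fun x => hAux z x (n+1) (i + 1 - (n+3)) := by
            funext x; rw [hAux, if_neg h1, if_neg h2]
          rw [this]
          exact ih _ (by omega) _

theorem hAux_letter {σ : Type} (z : σ) (x : ℕ → σ) (n : ℕ) :
    hAux z x n (n + 2) = some (x n) := by
  rw [hAux, if_neg (by omega), if_pos (by omega)]

theorem hAux_shift {σ : Type} (z : σ) (x : ℕ → σ) (n i : ℕ) :
    hAux z x n (n + 3 + i) = hAux z x (n + 1) i := by
  have e : n + 3 + i = (n + 2 + i) + 1 := by omega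
  rw [e, hAux, if_neg (by omega), if_neg (by omega)]
  congr 1
  omega

theorem hAux_eq_of_hmap_eq {σ : Type} (z : σ) (x y : ℕ → σ) (h : hmap z x = hmap z y) (n : ℕ) :
    ∀ i, hAux z x n i = hAux z y n i := by
  induction n with
  | zero => exact fun i => congrFun h i
  | succ n ih =>
    intro i
    rw [← hAux_shift, ← hAux_shift]
    exact ih _

/-- The coding map `h` is continuous and injective. -/
theorem hmap_continuous_injective (σ : Type) [Fintype σ] [Nonempty σ]
    [TopologicalSpace σ] [DiscreteTopology σ] (z : σ) :
    Continuous (hmap z) ∧ Function.Injective (hmap z) := by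
  refine ⟨continuous_pi fun i => hAux_continuous z i 0, fun x y h => funext fun n => ?_⟩
  have h2 := hAux_eq_of_hmap_eq z x y h n (n + 2)
  rw [hAux_letter, hAux_letter] at h2
  exact Option.some.inj h2
end

section
/- Let γ ≥ 2 be a countable ordinal, Γ a finite alphabet, and a ∈ Γ^ω a point. If 𝓛 ⊆ Γ^ω is Π⁰_γ-complete (respectively, Σ⁰_γ-complete), then the set R = (𝓛 × {a}) ∪ (Γ^ω × (Γ^ω − {a})), regarded as an ω-language over the product alphabet Γ × Γ, is Π⁰_γ-complete (respectively, Σ⁰_γ-complete). -/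
universe u

theorem sigma_union_aux {X : Type u} [TopologicalSpace X] (α : Ordinal.{0}) (hα : 1 ≤ α)
    (S : Set X) (hS : S ∈ SigmaPi X α true) (C : ℕ → Set X) (hC : ∀ n, IsClopen (C n)) :
    S ∪ ⋃ n, C n ∈ SigmaPi X α true := by
  rw [SigmaPi] at hS ⊢
  rcases hS with ⟨h1, h⟩ | ⟨h1, f, hf, hS⟩
  · left
    refine ⟨h1, Or.inl ⟨rfl, ?_⟩⟩
    have hS : IsOpen S := by simpa using h
    exact hS.union (isOpen_iUnion fun n => (hC n).isOpen)
  · right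
    have hlt : 1 < α := lt_of_le_of_ne hα (Ne.symm h1)
    refine ⟨h1, fun n => if n % 2 = 0 then f (n / 2) else C (n / 2), ?_, ?_⟩
    · intro n
      by_cases hn : n % 2 = 0
      · simpa only [hn, if_true] using hf (n / 2)
      · simp only [hn, if_false]
        refine ⟨1, hlt, ?_⟩
        rw [SigmaPi]
        exact Or.inl ⟨rfl, Or.inr ⟨rfl, (hC _).isClosed⟩⟩
    · rw [if_pos rfl] at hS ⊢
      subst hS
      ext x
      simp only [Set.mem_union, Set.mem_iUnion]
      constructor
      · rintro (⟨n, hn⟩ | ⟨n, hn⟩)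
        · refine ⟨2 * n, ?_⟩
          rw [if_pos (by omega), show 2 * n / 2 = n by omega]
          exact hn
        · refine ⟨2 * n + 1, ?_⟩
          rw [if_neg (by omega), show (2 * n + 1) / 2 = n by omega]
          exact hn
      · rintro ⟨n, hn⟩
        split_ifs at hn
        · exact Or.inl ⟨_, hn⟩
        · exact Or.inr ⟨_, hn⟩

theorem sigmaPi_pos_aux {X : Type u} [TopologicalSpace X] (α : Ordinal.{0}) (b : Bool)
    (S : Set X) (hS : S ∈ SigmaPi X α b) : 1 ≤ α := by
  rw [SigmaPi] at hS
  rcases hS with ⟨h1, h⟩ | ⟨h1, f, hf, hS⟩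
  · exact h1.ge
  · obtain ⟨β, hβ, _⟩ := hf 0
    exact Order.one_le_iff_pos.2 (lt_of_le_of_lt zero_le hβ)

theorem sigmaPi_union_aux {X : Type u} [TopologicalSpace X] (α : Ordinal.{0}) (hα : 2 ≤ α)
    (b : Bool) (S : Set X) (hS : S ∈ SigmaPi X α b) (C : ℕ → Set X)
    (hC : ∀ n, IsClopen (C n)) :
    S ∪ ⋃ n, C n ∈ SigmaPi X α b := by
  cases b with
  | true => exact sigma_union_aux α (sigmaPi_pos_aux _ _ _ hS) S hS C hC
  | false =>
    have hne : α ≠ 1 := by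
      rintro rfl
      exact absurd hα (not_le.2 (by exact_mod_cast Nat.one_lt_two))
    rw [SigmaPi] at hS ⊢
    rcases hS with ⟨h1, h⟩ | ⟨h1, f, hf, hS⟩
    · exact absurd h1 hne
    · right
      refine ⟨hne, fun n => f n ∪ ⋃ n, C n, ?_, ?_⟩
      · intro n
        obtain ⟨β, hβ, h⟩ := hf n
        exact ⟨β, hβ, sigma_union_aux β (sigmaPi_pos_aux _ _ _ h) _ h C hC⟩
      · rw [if_neg (by simp)] at hS ⊢
        rw [hS, Set.iInter_union]

/-- For a countable ordinal `γ ≥ 2`, a finite alphabet `Γ` and a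
point `a ∈ Γ^ω`: if `𝓛 ⊆ Γ^ω` is `Π⁰_γ`-complete (resp. `Σ⁰_γ`-complete), then
`R = (𝓛 × {a}) ∪ (Γ^ω × (Γ^ω − {a}))`, regarded as an ω-language over the
product alphabet `Γ × Γ`, is `Π⁰_γ`-complete (resp. `Σ⁰_γ`-complete) (the
boolean `b` selects the class: `true` for `Σ⁰_γ`, `false` for `Π⁰_γ`). -/
theorem prod_singleton_union_complete (Γ : Type) [Fintype Γ] [Nonempty Γ]
    [TopologicalSpace Γ] [DiscreteTopology Γ]
    (γ : Ordinal.{0}) (hγ : 2 ≤ γ) (hcount : γ.card ≤ Cardinal.aleph0)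
    (b : Bool) (a : ℕ → Γ) (𝓛 : Set (ℕ → Γ)) (h𝓛 : IsCompleteFor b γ 𝓛) :
    IsCompleteFor b γ
      {w : ℕ → Γ × Γ | (fun n => (w n).1, fun n => (w n).2) ∈
        (𝓛 ×ˢ ({a} : Set (ℕ → Γ))) ∪ (Set.univ ×ˢ ({a} : Set (ℕ → Γ))ᶜ)} := by
  intro Y _ _ E
  letI : TopologicalSpace Y := ⊥
  haveI : DiscreteTopology Y := ⟨rfl⟩
  have key := h𝓛 Y inferInstance inferInstance
  constructor
  · intro hE
    obtain ⟨f, hf, hEf⟩ := (key E).1 hE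
    refine ⟨fun x n => (f x n, a n), by fun_prop, ?_⟩
    rw [hEf]
    ext x
    simp
  · rintro ⟨f, hf, rfl⟩
    have h1 := (key ((fun x n => (f x n).1) ⁻¹' 𝓛)).2
      ⟨fun x n => (f x n).1, by fun_prop, rfl⟩
    have h2 := sigmaPi_union_aux γ hγ b _ h1 (fun n => (fun x => (f x n).2) ⁻¹' {a n}ᶜ)
      (fun n => (isClopen_discrete _).preimage (by fun_prop))
    convert h2 using 1
    ext x
    by_cases hx : (fun n => (f x n).2) = a
    · have hx' : ∀ n, (f x n).2 = a n := fun n => congrFun hx n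
      simp [hx, hx']
    · have hx' : ∃ n, (f x n).2 ≠ a n := by
        by_contra! hc
        exact hx (funext hc)
      simp [hx, hx']
end

section
/- Let Σ be a finite alphabet containing a letter 0, and let L ⊆ Σ^ω be accepted by a real-time Büchi 1-counter automaton. Then there exists an infinitary rational relation R₁ ⊆ Γ^ω × Γ^ω (where Γ = Σ ∪ {A}) such that for every x ∈ Σ^ω: x ∈ L if and only if (h(x), α₀) ∈ R₁. -/
universe u

namespace RatRelProof

/-! ### Matching finite words inside ω-words -/

/-- The finite word `l` occurs in `x` at position `i`. -/
def Mt {α : Type} (x : ℕ → α) : ℕ → List α → Prop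
  | _, [] => True
  | i, a :: l => x i = a ∧ Mt x (i + 1) l

theorem mt_append {α : Type} (x : ℕ → α) (l l' : List α) (i : ℕ) :
    Mt x i (l ++ l') ↔ Mt x i l ∧ Mt x (i + l.length) l' := by
  induction l generalizing i with
  | nil => simp [Mt]
  | cons a l ih =>
    simp only [List.cons_append, Mt, ih, List.length_cons, and_assoc]
    rw [show i + 1 + l.length = i + (l.length + 1) by omega]

theorem mt_iff {α : Type} (x : ℕ → α) (l : List α) (i : ℕ) :
    Mt x i l ↔ ∀ (k : ℕ) (h : k < l.length), l[k]'h = x (i + k) := by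
  induction l generalizing i with
  | nil => simp [Mt]
  | cons a l ih =>
    simp only [Mt, ih]
    constructor
    · rintro ⟨h0, h1⟩ k hk
      cases k with
      | zero => simpa using h0.symm
      | succ k =>
        have := h1 k (by simpa using hk)
        rw [show i + (k + 1) = i + 1 + k by omega]
        simpa using this
    · intro h
      refine ⟨(h 0 (by simp)).symm, fun k hk => ?_⟩
      have := h (k + 1) (by simpa using hk)
      rw [show i + 1 + k = i + (k + 1) by omega]
      simpa using this

/-- Total length of the first `n` words. -/
def pos {α : Type} (u : ℕ → List α) (n : ℕ) : ℕ := (((List.range n).map u).flatten).length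

theorem pos_zero {α : Type} (u : ℕ → List α) : pos u 0 = 0 := by simp [pos]

theorem flat_succ {α : Type} (u : ℕ → List α) (n : ℕ) :
    ((List.range (n + 1)).map u).flatten = ((List.range n).map u).flatten ++ u n := by
  simp [List.range_succ]

theorem pos_succ {α : Type} (u : ℕ → List α) (n : ℕ) :
    pos u (n + 1) = pos u n + (u n).length := by
  unfold pos
  rw [flat_succ, List.length_append]

theorem joins_iff {α : Type} (u : ℕ → List α) (x : ℕ → α) :
    JoinsTo u x ↔ (∀ N, ∃ n, N ≤ pos u n) ∧ ∀ n, Mt x (pos u n) (u n) := by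
  have key : ∀ n, (∀ (i : ℕ) (h : i < (((List.range n).map u).flatten).length),
      (((List.range n).map u).flatten)[i]'h = x i) ↔
      Mt x 0 (((List.range n).map u).flatten) := by
    intro n
    rw [mt_iff]
    simp
  unfold JoinsTo
  refine and_congr Iff.rfl ?_
  constructor
  · intro h n
    have := (key (n + 1)).1 (h (n + 1))
    rw [flat_succ, mt_append] at this
    simpa [pos] using this.2
  · intro h n
    rw [key]
    induction n with
    | zero => simp [Mt]
    | succ n ih =>
      rw [flat_succ, mt_append]
      exact ⟨ih, by simpa [pos] using h n⟩

/-! ### The ω-words `h(x)` and `α₀` -/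

/-- Start of block `n` of `h(x)`. -/
def P : ℕ → ℕ
  | 0 => 0
  | n + 1 => P n + (n + 3)

/-- Start of block `n` of `α₀`. -/
def B : ℕ → ℕ
  | 0 => 0
  | n + 1 => B n + (n + 2)

theorem le_P (n : ℕ) : n ≤ P n := by
  induction n with
  | zero => simp
  | succ n ih => simp only [P]; omega

theorem le_B (n : ℕ) : n ≤ B n := by
  induction n with
  | zero => simp
  | succ n ih => simp only [B]; omega

theorem hmap_P {σ : Type} (z : σ) (x : ℕ → σ) (n i : ℕ) :
    hmap z x (P n + i) = hAux z x n i := by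
  induction n generalizing i with
  | zero => simp [hmap, P]
  | succ n ih =>
    rw [P, add_assoc, ih, show n + 3 + i = (n + 2 + i) + 1 by omega, hAux]
    rw [if_neg (by omega), if_neg (by omega)]
    congr 1
    omega

theorem h_A {σ : Type} (z : σ) (x : ℕ → σ) (n : ℕ) : hmap z x (P n) = none := by
  have := hmap_P z x n 0
  rw [hAux] at this
  simpa using this

theorem h_Z {σ : Type} (z : σ) (x : ℕ → σ) (n i : ℕ) (h : i ≤ n) :
    hmap z x (P n + 1 + i) = some z := by
  rw [show P n + 1 + i = P n + (i + 1) by omega, hmap_P, hAux, if_pos (by omega)]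

theorem h_X {σ : Type} (z : σ) (x : ℕ → σ) (n : ℕ) :
    hmap z x (P n + n + 2) = some (x n) := by
  rw [show P n + n + 2 = P n + ((n + 1) + 1) by omega, hmap_P, hAux, if_neg (by omega),
    if_pos (by omega)]

theorem alpha_B {σ : Type} (z : σ) (n i : ℕ) :
    alphaWord z (B n + i) = aAux z n i := by
  induction n generalizing i with
  | zero => simp [alphaWord, B]
  | succ n ih =>
    rw [B, add_assoc, ih, show n + 2 + i = (n + 1 + i) + 1 by omega, aAux]
    rw [if_neg (by omega)]
    congr 1
    omega

theorem a_A {σ : Type} (z : σ) (n : ℕ) : alphaWord z (B n) = none := by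
  have := alpha_B z n 0
  rw [aAux] at this
  simpa using this

theorem a_Z {σ : Type} (z : σ) (n i : ℕ) (h : i ≤ n) :
    alphaWord z (B n + 1 + i) = some z := by
  rw [show B n + 1 + i = B n + (i + 1) by omega, alpha_B, aAux, if_pos (by omega)]

/-! ### The 2-tape automaton -/

variable {σ : Type}

/-- States: `none` is initial, `some (true, q, b)` reads the second part of the zeros of block
`n` of `h(x)` with the first part of block `n` of `α₀`; `some (false, q, b)` reads the first part
of block `n+1` of `h(x)` with the second part of block `n` of `α₀`. -/
abbrev St (M : OneCounterBuchi σ) : Type := Option (Bool × M.Q × Bool)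

inductive Tr (z : σ) (M : OneCounterBuchi σ) :
    St M → List (Option σ) → List (Option σ) → St M → Prop
  | ini : Tr z M none [none] [none] (some (true, M.init, false))
  | l1 (q : M.Q) (b : Bool) :
      Tr z M (some (true, q, b)) [some z] [some z] (some (true, q, b))
  | m0 (q : M.Q) (a : σ) (b : Bool) (q' : M.Q) : (q, a, b, q', (0 : ℤ)) ∈ M.trans →
      Tr z M (some (true, q, b)) [some a, none] [] (some (false, q', false))
  | mp (q : M.Q) (a : σ) (b : Bool) (q' : M.Q) : (q, a, b, q', (1 : ℤ)) ∈ M.trans →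
      Tr z M (some (true, q, b)) [some a, none, some z] [] (some (false, q', true))
  | mm (q : M.Q) (a : σ) (b : Bool) (q' : M.Q) : (q, a, b, q', (-1 : ℤ)) ∈ M.trans →
      Tr z M (some (true, q, b)) [some a, none] [some z] (some (false, q', false))
  | l2 (q : M.Q) (b : Bool) :
      Tr z M (some (false, q, b)) [some z] [some z] (some (false, q, true))
  | e (q : M.Q) (b : Bool) :
      Tr z M (some (false, q, b)) [] [none] (some (true, q, b))

theorem tr_finite [Finite σ] (z : σ) (M : OneCounterBuchi σ) :
    {t : St M × List (Option σ) × List (Option σ) × St M |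
      Tr z M t.1 t.2.1 t.2.2.1 t.2.2.2}.Finite := by
  have := M.finQ
  have hl : {l : List (Option σ) | l.length ≤ 3}.Finite := List.finite_length_le _ 3
  refine Set.Finite.subset
    ((Set.finite_univ (α := St M)).prod (hl.prod (hl.prod (Set.finite_univ (α := St M))))) ?_
  rintro ⟨s, u, v, s'⟩ h
  simp only [Set.mem_ofPred_eq] at h
  simp only [Set.mem_prod, Set.mem_univ, Set.mem_ofPred_eq, true_and, and_true]
  cases h <;> simp

/-- The 2-tape Büchi automaton simulating `M`. -/
def aut [Finite σ] (z : σ) (M : OneCounterBuchi σ) : TwoTapeBuchi (Option σ) (Option σ) where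
  Q := St M
  finQ := by have := M.finQ; infer_instance
  trans := {t | Tr z M t.1 t.2.1 t.2.2.1 t.2.2.2}
  finTrans := tr_finite z M
  init := none
  acc := {s | ∃ q ∈ M.acc, ∃ b, s = some (true, q, b)}

/-- Step between positioned configurations. -/
def CStep (z : σ) (M : OneCounterBuchi σ) (X Y : ℕ → Option σ)
    (d d' : St M × ℕ × ℕ) : Prop :=
  ∃ u v, Tr z M d.1 u v d'.1 ∧ Mt X d.2.1 u ∧ Mt Y d.2.2 v ∧
    d'.2.1 = d.2.1 + u.length ∧ d'.2.2 = d.2.2 + v.length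

/-- The configuration on entering block `n`. -/
def fresh (M : OneCounterBuchi σ) (n : ℕ) (p : M.Q × ℕ) : St M × ℕ × ℕ :=
  (some (true, p.1, decide (p.2 ≠ 0)), P n + 1 + p.2, B n + 1)

/-! ### From the 2-tape automaton to the counter automaton -/

theorem back2 (z : σ) (M : OneCounterBuchi σ) (x : ℕ → σ) (f : ℕ → St M × ℕ × ℕ)
    (hf : ∀ i, CStep z M (hmap z x) (alphaWord z) (f i) (f (i + 1)))
    (n c : ℕ) (hc : c ≤ n + 1) (q : M.Q) (d m t : ℕ) (hd : m + d = c)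
    (i2 : ℕ) (hi2 : i2 + c = B (n + 1) + m)
    (ht : f t = (some (false, q, decide (m ≠ 0)), P (n + 1) + 1 + m, i2)) :
    ∃ t', t < t' ∧ f t' = fresh M (n + 1) (q, c) ∧
      ∀ s, t ≤ s → s < t' → ∀ q' b, (f s).1 ≠ some (true, q', b) := by
  induction d generalizing m t i2 with
  | zero =>
    have hB : B (n + 1) = B n + (n + 2) := rfl
    obtain ⟨u, v, htr, h1, h2, e1, e2⟩ := hf t
    have hi : i2 = B (n + 1) := by omega
    rw [ht] at htr h1 h2 e1 e2
    generalize hg : f (t + 1) = g at *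
    obtain ⟨s', j1, j2⟩ := g
    simp only at htr h1 h2 e1 e2
    cases htr with
    | l2 =>
      simp only [Mt, hi, a_A] at h2
      simp at h2
    | e =>
      refine ⟨t + 1, by omega, ?_, ?_⟩
      · rw [hg]
        simp at e1 e2
        have : m = c := by omega
        subst this
        simp [fresh, e1, e2, hi]
      · intro s hs hs' q' b
        have : s = t := by omega
        subst this
        simp [ht]
  | succ d ih =>
    have hB : B (n + 1) = B n + (n + 2) := rfl
    obtain ⟨u, v, htr, h1, h2, e1, e2⟩ := hf t
    rw [ht] at htr h1 h2 e1 e2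
    generalize hg : f (t + 1) = g at *
    obtain ⟨s', j1, j2⟩ := g
    simp only at htr h1 h2 e1 e2
    cases htr with
    | l2 =>
      simp at e1 e2
      obtain ⟨t', h1', h2', h3'⟩ := ih (m + 1) (t + 1) (by omega) j2 (by omega)
        (by rw [hg]; simp [e1]; omega)
      refine ⟨t', by omega, h2', ?_⟩
      intro s hs hs' q' b
      by_cases h : s = t
      · subst h
        simp [ht]
      · exact h3' s (by omega) hs' q' b
    | e =>
      exfalso
      have := a_Z z n (i2 - (B n + 1)) (by omega)
      rw [show B n + 1 + (i2 - (B n + 1)) = i2 by omega] at this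
      simp [Mt, this] at h2

theorem move_pos (z : σ) (x : ℕ → σ) (n e : ℕ) (a : σ) (he : e ≤ n + 2)
    (h1 : hmap z x (P n + 1 + e) = some a) (h2 : hmap z x (P n + 1 + e + 1) = none) :
    e = n + 1 ∧ a = x n := by
  have hP : P (n + 1) = P n + (n + 3) := rfl
  rcases Nat.lt_trichotomy e (n + 1) with h | h | h
  · exfalso
    by_cases h' : e = n
    · subst h'
      rw [show P e + 1 + e + 1 = P e + e + 2 by omega, h_X] at h2
      simp at h2
    · have := h_Z z x n (e + 1) (by omega)
      rw [show P n + 1 + (e + 1) = P n + 1 + e + 1 by omega, h2] at this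
      simp at this
  · refine ⟨h, ?_⟩
    rw [show P n + 1 + e = P n + n + 2 by omega, h_X] at h1
    simpa using h1.symm
  · exfalso
    have := h_A z x (n + 1)
    rw [show P (n + 1) = P n + 1 + e by omega, h1] at this
    simp at this

theorem back1 (z : σ) (M : OneCounterBuchi σ) (x : ℕ → σ) (f : ℕ → St M × ℕ × ℕ)
    (hf : ∀ i, CStep z M (hmap z x) (alphaWord z) (f i) (f (i + 1)))
    (n c : ℕ) (hc : c ≤ n) (q : M.Q) (d k t : ℕ) (hd : k + d = n + 1)
    (hck : c + k ≤ n + 2)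
    (ht : f t = (some (true, q, decide (c ≠ 0)), P n + 1 + (c + k), B n + 1 + k)) :
    ∃ t' p', t < t' ∧ f t' = fresh M (n + 1) p' ∧ p'.2 ≤ n + 1 ∧ M.Step (x n) (q, c) p' ∧
      ∀ s, t ≤ s → s < t' → ∀ q' b, (f s).1 = some (true, q', b) → q' = q := by
  induction d using Nat.strong_induction_on generalizing k t with
  | _ d ih =>
    have hB : B (n + 1) = B n + (n + 2) := rfl
    have hP : P (n + 1) = P n + (n + 3) := rfl
    obtain ⟨u, v, htr, h1, h2, e1, e2⟩ := hf t
    rw [ht] at htr h1 h2 e1 e2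
    generalize hg : f (t + 1) = g at *
    obtain ⟨s', j1, j2⟩ := g
    simp only at htr h1 h2 e1 e2
    have fin : ∀ q' c' m, M.Step (x n) (q, c) (q', c') → c' ≤ n + 1 → m ≤ c' →
        s' = some (false, q', decide (m ≠ 0)) → j1 = P (n + 1) + 1 + m →
        j2 + c' = B (n + 1) + m → 
        ∃ t' p', t < t' ∧ f t' = fresh M (n + 1) p' ∧ p'.2 ≤ n + 1 ∧ M.Step (x n) (q, c) p' ∧
        ∀ s, t ≤ s → s < t' → ∀ q' b, (f s).1 = some (true, q', b) → q' = q := by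
      intro q' c' m hst hc' hm hs hj1 hj2
      obtain ⟨t', h1', h2', h3'⟩ := back2 z M x f hf n c' hc' q' (c' - m) m (t + 1) (by omega)
        j2 hj2 (by rw [hg, hs, hj1])
      refine ⟨t', (q', c'), by omega, h2', hc', hst, ?_⟩
      intro s hs hs' q'' b hq
      by_cases h : s = t
      · subst h
        rw [ht] at hq
        simp at hq
        exact hq.1.symm
      · exact absurd hq (h3' s (by omega) hs' q'' b)
    cases htr with
    | l1 =>
      simp only [Mt, and_true] at h1 h2
      have hk : k ≤ n := by
        by_contra hk
        rw [show B n + 1 + k = B (n + 1) by omega, a_A] at h2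
        simp at h2
      have hk2 : c + k ≤ n + 1 := by
        by_contra hk
        rw [show P n + 1 + (c + k) = P (n + 1) by omega, h_A] at h1
        simp at h1
      simp at e1 e2
      obtain ⟨t', p', a1, a2, a3, a4, a5⟩ := ih (d - 1) (by omega) (k + 1) (t + 1) (by omega)
        (by omega) (by rw [hg, e1, e2]; simp; omega)
      refine ⟨t', p', by omega, a2, a3, a4, ?_⟩
      intro s hs hs' q'' b hq
      by_cases h : s = t
      · subst h
        rw [ht] at hq
        simp at hq
        exact hq.1.symm
      · exact a5 s (by omega) hs' q'' b hq
    | m0 _ a _ q' hm =>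
      simp only [Mt, and_true] at h1
      obtain ⟨hk, rfl⟩ := move_pos z x n (c + k) a hck h1.1 h1.2
      simp at e1 e2
      exact fin q' c 0 ⟨0, by simpa using hm, by simp⟩ (by omega) (by omega) (by simp)
        (by omega) (by omega)
    | mp _ a _ q' hm =>
      simp only [Mt, and_true] at h1
      obtain ⟨hk, rfl⟩ := move_pos z x n (c + k) a hck h1.1 h1.2.1
      simp at e1 e2
      exact fin q' (c + 1) 1 ⟨1, by simpa using hm, by simp⟩ (by omega) (by omega) (by simp)
        (by omega) (by omega)
    | mm _ a _ q' hm =>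
      simp only [Mt, and_true] at h1
      obtain ⟨hk, rfl⟩ := move_pos z x n (c + k) a hck h1.1 h1.2
      simp at e1 e2
      have hc0 : c ≠ 0 := by
        intro h0
        have := M.transZero _ hm (by simp [h0])
        simp at this
      exact fin q' (c - 1) 0 ⟨-1, by simpa using hm, by simp only; omega⟩ (by omega) (by omega)
        (by simp) (by omega) (by omega)

theorem back (z : σ) (M : OneCounterBuchi σ) (x : ℕ → σ) (f : ℕ → St M × ℕ × ℕ)
    (hf : ∀ i, CStep z M (hmap z x) (alphaWord z) (f i) (f (i + 1)))
    (h0 : f 0 = (none, 0, 0))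
    (hacc : ∃ q ∈ M.acc, ∃ b, ∀ n, ∃ m, n ≤ m ∧ (f m).1 = some (true, q, b)) :
    M.Accepts x := by
  have hini : f 1 = fresh M 0 (M.init, 0) := by
    obtain ⟨u, v, htr, h1, h2, e1, e2⟩ := hf 0
    rw [h0] at htr h1 h2 e1 e2
    generalize hg : f (0 + 1) = g at *
    obtain ⟨s', j1, j2⟩ := g
    simp only at htr h1 h2 e1 e2
    cases htr with
    | ini =>
      simp at e1 e2 hg
      simp [fresh, e1, e2, P, B]
  -- configurations on entering a block
  let Good : ℕ → ℕ × (M.Q × ℕ) → Prop := fun n g => f g.1 = fresh M n g.2 ∧ g.2.2 ≤ n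
  have hnext : ∀ n (g : ℕ × (M.Q × ℕ)), Good n g → ∃ g', Good (n + 1) g' ∧ g.1 < g'.1 ∧
      M.Step (x n) g.2 g'.2 ∧
      ∀ s, g.1 ≤ s → s < g'.1 → ∀ q' b, (f s).1 = some (true, q', b) → q' = g.2.1 := by
    rintro n ⟨t, q, c⟩ ⟨hg1, hg2⟩
    obtain ⟨t', p', a1, a2, a3, a4, a5⟩ := back1 z M x f hf n c hg2 q (n + 1) 0 t (by omega)
      (by simp only at hg2; omega) (by rw [hg1]; simp [fresh])
    exact ⟨(t', p'), ⟨a2, a3⟩, a1, a4, a5⟩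
  choose! nx hnx using hnext
  let G : ℕ → ℕ × (M.Q × ℕ) := fun n => Nat.rec (1, (M.init, 0)) (fun n g => nx n g) n
  have hG : ∀ n, Good n (G n) := by
    intro n
    induction n with
    | zero => exact ⟨hini, le_refl _⟩
    | succ n ih => exact (hnx n _ ih).1
  have hmono : StrictMono (fun n => (G n).1) :=
    strictMono_nat_of_lt_succ fun n => (hnx n _ (hG n)).2.1
  obtain ⟨q, hq, b, hinf⟩ := hacc
  refine ⟨fun n => (G n).2, rfl, fun n => (hnx n _ (hG n)).2.2.1, q, hq, ?_⟩
  intro N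
  obtain ⟨s, hs, hsq⟩ := hinf (G N).1
  -- the block containing `s`
  have hex : ∃ n, s < (G n).1 := ⟨s + 1, hmono.le_apply⟩
  classical
  have hN : N < Nat.find hex := by
    by_contra hlt
    have h1 := Nat.find_spec hex
    have h2 : (G (Nat.find hex)).1 ≤ (G N).1 := hmono.monotone (not_lt.1 hlt)
    omega
  have hmin : ¬ s < (G (Nat.find hex - 1)).1 := Nat.find_min hex (by omega)
  refine ⟨Nat.find hex - 1, by omega, ?_⟩
  have h3 := (hnx _ _ (hG (Nat.find hex - 1))).2.2.2 s (not_lt.1 hmin) (by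
    have h1 := Nat.find_spec hex
    have h2 : G (Nat.find hex) = nx (Nat.find hex - 1) (G (Nat.find hex - 1)) := by
      conv_lhs => rw [show Nat.find hex = (Nat.find hex - 1) + 1 by omega]
    rw [← h2]
    exact h1) q b hsq
  exact h3.symm

/-! ### Gluing finite paths -/

theorem path_of_rtg {α : Type} (s : α → α → Prop) (a b : α) (h : Relation.ReflTransGen s a b) :
    ∃ (l : ℕ) (p : ℕ → α), p 0 = a ∧ p l = b ∧ ∀ i < l, s (p i) (p (i + 1)) := by
  induction h using Relation.ReflTransGen.head_induction_on with
  | refl => exact ⟨0, fun _ => b, rfl, rfl, by simp⟩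
  | @head a c hac _ ih =>
    obtain ⟨l, p, h0, h1, h2⟩ := ih
    refine ⟨l + 1, fun i => Nat.casesOn i a p, rfl, h1, ?_⟩
    rintro (_ | i) hi
    · simpa [h0] using hac
    · exact h2 i (by omega)

theorem glue {α : Type} (s : α → α → Prop) (C : ℕ → α)
    (h : ∀ n, Relation.TransGen s (C n) (C (n + 1))) :
    ∃ f : ℕ → α, f 0 = C 0 ∧ (∀ i, s (f i) (f (i + 1))) ∧
      ∃ t : ℕ → ℕ, StrictMono t ∧ ∀ n, f (t n) = C n := by
  have hp : ∀ n, ∃ (l : ℕ) (p : ℕ → α), 0 < l ∧ p 0 = C n ∧ p l = C (n + 1) ∧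
      ∀ i < l, s (p i) (p (i + 1)) := by
    intro n
    obtain ⟨c, h1, h2⟩ := Relation.TransGen.head'_iff.1 (h n)
    obtain ⟨l, p, a0, a1, a2⟩ := path_of_rtg s _ _ h2
    refine ⟨l + 1, fun i => Nat.casesOn i (C n) p, by omega, rfl, a1, ?_⟩
    rintro (_ | i) hi
    · simpa [a0] using h1
    · exact a2 i (by omega)
  choose l p hl h0 h1 h2 using hp
  let t : ℕ → ℕ := fun n => ∑ i ∈ Finset.range n, l i
  have ht0 : t 0 = 0 := by simp [t]
  have hts : ∀ n, t (n + 1) = t n + l n := fun n => Finset.sum_range_succ _ _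
  have hmono : StrictMono t := strictMono_nat_of_lt_succ fun n => by
    have := hl n
    rw [hts]; omega
  have hex : ∀ i, ∃ n, t n ≤ i ∧ i < t (n + 1) := by
    intro i
    induction i with
    | zero => exact ⟨0, by omega, by have := hl 0; rw [hts]; omega⟩
    | succ i ih =>
      obtain ⟨n, a, b⟩ := ih
      by_cases hlt : i + 1 < t (n + 1)
      · exact ⟨n, by omega, hlt⟩
      · exact ⟨n + 1, by omega, by have := hl (n + 1); rw [hts (n + 1)]; omega⟩
  choose N hN1 hN2 using hex
  have huniq : ∀ i n, t n ≤ i → i < t (n + 1) → N i = n := by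
    intro i n a b
    have c1 : N i < n + 1 := hmono.lt_iff_lt.1 (lt_of_le_of_lt (hN1 i) b)
    have c2 : n < N i + 1 := hmono.lt_iff_lt.1 (lt_of_le_of_lt a (hN2 i))
    omega
  have hft : ∀ n, N (t n) = n := fun n => huniq _ _ le_rfl (hmono (Nat.lt_succ_self n))
  have hC : ∀ n, p (N (t n)) (t n - t (N (t n))) = C n := by
    intro n
    rw [hft]; simp [h0]
  refine ⟨fun i => p (N i) (i - t (N i)), ?_, ?_, t, hmono, hC⟩
  · have := hC 0
    rwa [ht0] at this
  · intro i
    have a1 := hN1 i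
    have a2 := hN2 i
    have a3 := hts (N i)
    have key := h2 (N i) (i - t (N i)) (by omega)
    by_cases hlt : i + 1 < t (N i + 1)
    · have : N (i + 1) = N i := huniq _ _ (by omega) hlt
      simp only [this]
      rwa [show i + 1 - t (N i) = i - t (N i) + 1 by omega]
    · have e : i + 1 = t (N i + 1) := by omega
      have := hC (N i + 1)
      rw [← e] at this
      simp only [this]
      rw [← h1 (N i)]
      rwa [show i - t (N i) + 1 = l (N i) by omega] at key

/-! ### From the counter automaton to the 2-tape automaton -/

theorem fwd1 (z : σ) (M : OneCounterBuchi σ) (x : ℕ → σ) (n c d : ℕ) (q : M.Q)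
    (k : ℕ) (b : Bool) (hd : c + k + d = n + 1) :
    Relation.ReflTransGen (CStep z M (hmap z x) (alphaWord z))
      (some (true, q, b), P n + 1 + (c + k), B n + 1 + k)
      (some (true, q, b), P n + n + 2, B n + 1 + (n + 1 - c)) := by
  induction d generalizing k with
  | zero =>
    rw [show P n + 1 + (c + k) = P n + n + 2 by omega, show n + 1 - c = k by omega]
  | succ d ih =>
    refine Relation.ReflTransGen.head ?_ (ih (k + 1) (by omega))
    exact ⟨[some z], [some z], Tr.l1 q b, by simp [Mt, h_Z z x n (c + k) (by omega)],
      by simp [Mt, a_Z z n k (by omega)], by simp; omega, by simp; omega⟩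

theorem fwd2 (z : σ) (M : OneCounterBuchi σ) (x : ℕ → σ) (n c : ℕ) (hc : c ≤ n + 1)
    (d : ℕ) (q : M.Q) (m i2 : ℕ) (hd : m + d = c) (hi2 : i2 + c = B (n + 1) + m) :
    Relation.ReflTransGen (CStep z M (hmap z x) (alphaWord z))
      (some (false, q, decide (m ≠ 0)), P (n + 1) + 1 + m, i2) (fresh M (n + 1) (q, c)) := by
  have hB : B (n + 1) = B n + (n + 2) := rfl
  induction d generalizing m i2 with
  | zero =>
    obtain rfl : m = c := by omega
    obtain rfl : i2 = B (n + 1) := by omega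
    refine Relation.ReflTransGen.single ?_
    exact ⟨[], [none], Tr.e _ _, by simp [Mt], by simp [Mt, a_A], by simp [fresh],
      by simp [fresh]⟩
  | succ d ih =>
    refine Relation.ReflTransGen.head ?_ (ih (m + 1) (i2 + 1) (by omega) (by omega))
    have := a_Z z n (i2 - (B n + 1)) (by omega)
    rw [show B n + 1 + (i2 - (B n + 1)) = i2 by omega] at this
    refine ⟨[some z], [some z], ?_, by simp [Mt, h_Z z x (n + 1) m (by omega)],
      by simp [Mt, this], by simp; omega, by simp⟩
    simpa using Tr.l2 q (decide (m ≠ 0))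

theorem fwd (z : σ) (M : OneCounterBuchi σ) (x : ℕ → σ) (n : ℕ) (p p' : M.Q × ℕ)
    (hp : p.2 ≤ n) (hst : M.Step (x n) p p') :
    Relation.TransGen (CStep z M (hmap z x) (alphaWord z)) (fresh M n p)
      (fresh M (n + 1) p') := by
  obtain ⟨q, c⟩ := p
  obtain ⟨q', c'⟩ := p'
  obtain ⟨j, hj, hc'⟩ := hst
  simp only at hp hj hc'
  have hB : B (n + 1) = B n + (n + 2) := rfl
  have hP : P (n + 1) = P n + (n + 3) := rfl
  have hx1 := h_X z x n
  have hx2 : hmap z x (P n + n + 2 + 1) = none := by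
    rw [show P n + n + 2 + 1 = P (n + 1) by omega, h_A]
  have h1 := fwd1 z M x n c (n + 1 - c) q 0 (decide (c ≠ 0)) (by omega)
  simp only [add_zero] at h1
  refine Relation.TransGen.trans_right h1 ?_
  rcases M.transMoves _ hj with h | h | h <;> simp only at h <;> subst h
  · have ha := a_Z z n (n + 1 - c) (by omega)
    refine Relation.TransGen.head' ?_ (fwd2 z M x n c' (by omega) c' q' 0
      (B n + 1 + (n + 1 - c) + 1) (by omega) (by omega))
    exact ⟨[some (x n), none], [some z], by simpa using Tr.mm q (x n) _ q' hj,
      by simp [Mt, hx1, hx2], by simp [Mt, ha], by simp; omega, by simp⟩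
  · refine Relation.TransGen.head' ?_ (fwd2 z M x n c' (by omega) c' q' 0
      (B n + 1 + (n + 1 - c)) (by omega) (by omega))
    exact ⟨[some (x n), none], [], by simpa using Tr.m0 q (x n) _ q' hj,
      by simp [Mt, hx1, hx2], by simp [Mt], by simp; omega, by simp⟩
  · have hz := h_Z z x (n + 1) 0 (by omega)
    rw [show P (n + 1) + 1 + 0 = P n + n + 2 + 1 + 1 by omega] at hz
    refine Relation.TransGen.head' ?_ (fwd2 z M x n c' (by omega) (c' - 1) q' 1
      (B n + 1 + (n + 1 - c)) (by omega) (by omega))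
    exact ⟨[some (x n), none, some z], [], by simpa using Tr.mp q (x n) _ q' hj,
      by simp [Mt, hx1, hx2, hz], by simp [Mt], by simp; omega, by simp⟩

theorem forward (z : σ) (M : OneCounterBuchi σ) (x : ℕ → σ) (h : M.Accepts x) :
    ∃ f : ℕ → St M × ℕ × ℕ, f 0 = (none, 0, 0) ∧
      (∀ i, CStep z M (hmap z x) (alphaWord z) (f i) (f (i + 1))) ∧
      (∃ q ∈ M.acc, ∃ b, ∀ n, ∃ m, n ≤ m ∧ (f m).1 = some (true, q, b)) ∧
      ∀ n, ∃ m, n ≤ (f m).2.1 ∧ n ≤ (f m).2.2 := by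
  obtain ⟨r, hr0, hr, q, hq, hinf⟩ := h
  have hle : ∀ n, (r n).2 ≤ n := by
    intro n
    induction n with
    | zero => simp [hr0]
    | succ n ih =>
      obtain ⟨j, hj, hc⟩ := hr n
      have := M.transMoves _ hj
      simp only at this
      omega
  obtain ⟨f, hf0, hfs, t, ht, hft⟩ := glue (CStep z M (hmap z x) (alphaWord z))
    (fun n => Nat.casesOn n (none, 0, 0) (fun n => fresh M n (r n))) (by
      rintro (_ | n)
      · refine Relation.TransGen.single ⟨[none], [none], ?_, ?_, ?_, ?_, ?_⟩
        · simpa [fresh, hr0] using Tr.ini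
        · simpa [Mt, P] using h_A z x 0
        · simpa [Mt, B] using a_A z 0
        · simp [fresh, hr0, P]
        · simp [fresh, B]
      · exact fwd z M x n _ _ (hle n) (hr n))
  have hft' : ∀ n, f (t (n + 1)) = fresh M n (r n) := fun n => hft (n + 1)
  refine ⟨f, hf0, hfs, ?_, ?_⟩
  · refine ⟨q, hq, ?_⟩
    by_contra hcon
    push Not at hcon
    obtain ⟨n1, hn1⟩ := hcon true
    obtain ⟨n2, hn2⟩ := hcon false
    obtain ⟨m, hm, hmq⟩ := hinf (n1 + n2)
    have hle' : m + 1 ≤ t (m + 1) := ht.le_apply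
    have a1 := hn1 (t (m + 1)) (by omega)
    have a2 := hn2 (t (m + 1)) (by omega)
    rw [hft'] at a1 a2
    simp only [fresh, hmq] at a1 a2
    cases hb : decide ((r m).2 ≠ 0) <;> simp_all
  · intro n
    refine ⟨t (n + 1), ?_⟩
    rw [hft']
    have := le_P n
    have := le_B n
    simp only [fresh]
    omega

theorem aut_accepts [Finite σ] (z : σ) (M : OneCounterBuchi σ) (X Y : ℕ → Option σ) :
    (aut z M).Accepts X Y ↔ ∃ f : ℕ → St M × ℕ × ℕ, f 0 = (none, 0, 0) ∧
      (∀ i, CStep z M X Y (f i) (f (i + 1))) ∧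
      (∃ q ∈ M.acc, ∃ b, ∀ n, ∃ m, n ≤ m ∧ (f m).1 = some (true, q, b)) ∧
      ∀ n, ∃ m, n ≤ (f m).2.1 ∧ n ≤ (f m).2.2 := by
  have posmono : ∀ (u : ℕ → List (Option σ)), Monotone (pos u) := fun u =>
    monotone_nat_of_le_succ fun n => by rw [pos_succ]; omega
  constructor
  · rintro ⟨q, u, v, h0, htr, ⟨qf, ⟨q0, hq0, b, rfl⟩, hinf⟩, hu, hv⟩
    rw [joins_iff] at hu hv
    refine ⟨fun n => (q n, pos u n, pos v n), ?_, ?_, ⟨q0, hq0, b, hinf⟩, ?_⟩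
    · simp only [pos_zero, h0]
      rfl
    · intro i
      exact ⟨u i, v i, htr i, hu.2 i, hv.2 i, pos_succ _ _, pos_succ _ _⟩
    · intro n
      obtain ⟨m1, h1⟩ := hu.1 n
      obtain ⟨m2, h2⟩ := hv.1 n
      exact ⟨max m1 m2, h1.trans (posmono u (le_max_left _ _)),
        h2.trans (posmono v (le_max_right _ _))⟩
  · rintro ⟨f, h0, hs, ⟨q0, hq0, b, hinf⟩, hub⟩
    choose u v htr hu hv e1 e2 using hs
    have p1 : ∀ n, pos u n = (f n).2.1 := by
      intro n
      induction n with
      | zero => simp [pos_zero, h0]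
      | succ n ih => rw [pos_succ, ih, e1]
    have p2 : ∀ n, pos v n = (f n).2.2 := by
      intro n
      induction n with
      | zero => simp [pos_zero, h0]
      | succ n ih => rw [pos_succ, ih, e2]
    refine ⟨fun n => (f n).1, u, v, ?_, htr, ⟨some (true, q0, b), ⟨q0, hq0, b, rfl⟩, hinf⟩,
      ?_, ?_⟩
    · simp only [h0]
      rfl
    · rw [joins_iff]
      refine ⟨fun N => ?_, fun n => ?_⟩
      · obtain ⟨m, h1, h2⟩ := hub N
        exact ⟨m, by rw [p1]; exact h1⟩
      · rw [p1]; exact hu n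
    · rw [joins_iff]
      refine ⟨fun N => ?_, fun n => ?_⟩
      · obtain ⟨m, h1, h2⟩ := hub N
        exact ⟨m, by rw [p2]; exact h2⟩
      · rw [p2]; exact hv n

end RatRelProof

/-- If `L ⊆ Σ^ω` is accepted by a real-time Büchi 1-counter
automaton, then there is an infinitary rational relation
`R₁ ⊆ Γ^ω × Γ^ω` (with `Γ = Σ ∪ {A}`) such that for every `x ∈ Σ^ω`:
`x ∈ L` iff `(h(x), α₀) ∈ R₁`. -/
theorem exists_ratRel_of_oneCounter (σ : Type) [Fintype σ] [Nonempty σ]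
    (z : σ) (L : Set (ℕ → σ)) (M : OneCounterBuchi σ)
    (hL : L = {x | M.Accepts x}) :
    ∃ R₁ : Set ((ℕ → Option σ) × (ℕ → Option σ)),
      IsRatRel R₁ ∧ ∀ x : ℕ → σ, x ∈ L ↔ (hmap z x, alphaWord z) ∈ R₁ := by
  subst hL
  refine ⟨{p | (RatRelProof.aut z M).Accepts p.1 p.2}, ⟨RatRelProof.aut z M, fun p => Iff.rfl⟩, ?_⟩
  intro x
  change M.Accepts x ↔ (RatRelProof.aut z M).Accepts (hmap z x) (alphaWord z)
  rw [RatRelProof.aut_accepts]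
  constructor
  · exact RatRelProof.forward z M x
  · rintro ⟨f, h0, hf, hacc, -⟩
    exact RatRelProof.back z M x f hf h0 hacc
end

section
/- Let Σ be a finite alphabet containing a letter 0, A a letter not in Σ, and Γ = Σ ∪ {A}. The set R₂ = (Γ^ω × Γ^ω) − (h(Σ^ω) × {α₀}) is an infinitary rational relation. -/
universe u

namespace RatProof

/-- The finite word `l` occurs in `x` at position `i`. -/
def Mt {α : Type} : List α → (ℕ → α) → ℕ → Prop
  | [], _, _ => True
  | a :: l, x, i => a = x i ∧ Mt l x (i + 1)

theorem mt_iff {α : Type} (l : List α) (x : ℕ → α) (i : ℕ) :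
    Mt l x i ↔ ∀ k (h : k < l.length), l[k] = x (i + k) := by
  induction l generalizing i with
  | nil => simp [Mt]
  | cons a l ih =>
    simp only [Mt, ih]
    constructor
    · rintro ⟨h0, h⟩ k hk
      cases k with
      | zero => simpa using h0
      | succ k =>
        have := h k (by simpa using hk)
        simp only [List.getElem_cons_succ, this]
        congr 1
        omega
    · intro h
      refine ⟨h 0 (by simp), fun k hk => ?_⟩
      have := h (k + 1) (by simpa using hk)
      simp only [List.getElem_cons_succ] at this
      rw [this]
      congr 1
      omega

theorem mt_append {α : Type} (l l' : List α) (x : ℕ → α) (i : ℕ) :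
    Mt (l ++ l') x i ↔ Mt l x i ∧ Mt l' x (i + l.length) := by
  induction l generalizing i with
  | nil => simp [Mt]
  | cons a l ih =>
    simp only [List.cons_append, Mt, ih, List.length_cons, and_assoc]
    rw [show i + 1 + l.length = i + (l.length + 1) by omega]

theorem mt_shift {α : Type} (l : List α) (x : ℕ → α) (i j : ℕ) :
    Mt l (fun k => x (i + k)) j ↔ Mt l x (i + j) := by
  induction l generalizing j with
  | nil => simp [Mt]
  | cons a l ih =>
    simp only [Mt, ih, add_assoc]

/-- Partial concatenation. -/
def cat {α : Type} (u : ℕ → List α) (n : ℕ) : List α := ((List.range n).map u).flatten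

theorem cat_succ {α : Type} (u : ℕ → List α) (n : ℕ) : cat u (n + 1) = cat u n ++ u n := by
  simp [cat, List.range_succ]

theorem cat_cons {α : Type} (w : List α) (u : ℕ → List α) (n : ℕ) :
    cat (fun n => Nat.casesOn n w u) (n + 1) = w ++ cat u n := by
  induction n with
  | zero => simp [cat]
  | succ n ih => rw [cat_succ, ih, cat_succ, List.append_assoc]

theorem joinsTo_iff {α : Type} (u : ℕ → List α) (x : ℕ → α) :
    JoinsTo u x ↔ (∀ N, ∃ n, N ≤ (cat u n).length) ∧ ∀ n, Mt (cat u n) x 0 := by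
  simp only [JoinsTo, mt_iff, zero_add]
  rfl

theorem joinsTo_cons {α : Type} (w : List α) (u : ℕ → List α) (x : ℕ → α) (i : ℕ)
    (hw : Mt w x i) (h : JoinsTo u (fun k => x (i + w.length + k))) :
    JoinsTo (fun n => Nat.casesOn n w u) (fun k => x (i + k)) := by
  rw [joinsTo_iff] at h ⊢
  refine ⟨fun N => ?_, fun n => ?_⟩
  · obtain ⟨n, hn⟩ := h.1 N
    refine ⟨n + 1, ?_⟩
    rw [cat_cons]
    simp only [List.length_append]
    omega
  · cases n with
    | zero => simp [cat, Mt]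
    | succ n =>
      rw [cat_cons, mt_append]
      have h2 := h.2 n
      rw [mt_shift] at h2
      refine ⟨(mt_shift _ _ _ _).2 hw, (mt_shift _ _ _ _).2 ?_⟩
      simpa using h2

theorem joinsTo_single {α : Type} (x : ℕ → α) : JoinsTo (fun n => [x n]) x := by
  rw [joinsTo_iff]
  have hl : ∀ n, (cat (fun n => [x n]) n).length = n := by
    intro n
    induction n with
    | zero => simp [cat]
    | succ n ih => simp [cat_succ, ih]
  refine ⟨fun N => ⟨N, (hl N).ge⟩, fun n => ?_⟩
  induction n with
  | zero => simp [cat, Mt]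
  | succ n ih =>
    rw [cat_succ, mt_append]
    refine ⟨ih, ?_⟩
    simp [Mt, hl]

/-- States of the automaton. -/
inductive St : Type
  | start | c1 | c2 | top

theorem finite_St : Finite St := by
  refine Finite.of_injective (β := Fin 4)
    (fun s => match s with | .start => 0 | .c1 => 1 | .c2 => 2 | .top => 3) ?_
  intro a b h
  cases a <;> cases b <;> simp at h ⊢

/-- No error in the first five letters of the first tape and first letter of the second. -/
def Good0 {σ : Type} (z : σ) (a b c d e f : Option σ) : Prop :=
  a = none ∧ b = some z ∧ c ≠ none ∧ d = none ∧ e = some z ∧ f = none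

def Good1 {σ : Type} (z : σ) (a b f : Option σ) : Prop :=
  (f = some z ∧ a = some z) ∨ (f = none ∧ a ≠ none ∧ b = none)

def Good2 {σ : Type} (z : σ) (a b c f : Option σ) : Prop :=
  (f = some z ∧ a = some z) ∨ (f = none ∧ a ≠ none ∧ b = none ∧ c = some z)

/-- Transitions of the automaton. -/
inductive Tr {σ : Type} (z : σ) : St → List (Option σ) → List (Option σ) → St → Prop
  | i1 : Tr z .start [none] [none] .c1
  | i2 (c : Option σ) : c ≠ none → Tr z .start [none, some z, c, none, some z] [none] .c2
  | i3 (a b c d e f : Option σ) : ¬ Good0 z a b c d e f → Tr z .start [a, b, c, d, e] [f] .top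
  | z1 : Tr z .c1 [some z] [some z] .c1
  | b1 (a : Option σ) : a ≠ none → Tr z .c1 [a, none] [none] .c1
  | e1 (a b f : Option σ) : ¬ Good1 z a b f → Tr z .c1 [a, b] [f] .top
  | z2 : Tr z .c2 [some z] [some z] .c2
  | b2 (a : Option σ) : a ≠ none → Tr z .c2 [a, none, some z] [none] .c2
  | e2 (a b c f : Option σ) : ¬ Good2 z a b c f → Tr z .c2 [a, b, c] [f] .top
  | l (a b : Option σ) : Tr z .top [a] [b] .top

theorem Tr.len {σ : Type} {z : σ} {q q' : St} {u v : List (Option σ)} (h : Tr z q u v q') :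
    u.length ≤ 5 ∧ v.length ≤ 5 := by
  cases h <;> simp

/-- The automaton, started in state `s`. -/
def aut {σ : Type} [Fintype σ] (z : σ) (s : St) : TwoTapeBuchi (Option σ) (Option σ) where
  Q := St
  finQ := finite_St
  trans := {t | Tr z t.1 t.2.1 t.2.2.1 t.2.2.2}
  finTrans := by
    haveI := finite_St
    refine Set.Finite.subset ((Set.finite_univ (α := St)).prod
      ((List.finite_length_le (Option σ) 5).prod
        ((List.finite_length_le (Option σ) 5).prod (Set.finite_univ (α := St))))) ?_
    rintro ⟨q, u, v, q'⟩ h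
    have := Tr.len h
    simpa using this
  init := s
  acc := {St.top}

theorem acc_top {σ : Type} [Fintype σ] (z : σ) (x y : ℕ → Option σ) :
    (aut z .top).Accepts x y :=
  ⟨fun _ => St.top, fun n => [x n], fun n => [y n], rfl, fun _ => Tr.l _ _,
    ⟨St.top, rfl, fun n => ⟨n, le_rfl, rfl⟩⟩, joinsTo_single x, joinsTo_single y⟩

theorem acc_step {σ : Type} [Fintype σ] (z : σ) (x y : ℕ → Option σ) {q q' : St}
    {u v : List (Option σ)} (ht : Tr z q u v q') {i j : ℕ} (hu : Mt u x i) (hv : Mt v y j)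
    (h : (aut z q').Accepts (fun k => x (i + u.length + k)) (fun k => y (j + v.length + k))) :
    (aut z q).Accepts (fun k => x (i + k)) (fun k => y (j + k)) := by
  obtain ⟨r, us, vs, h0, h1, ⟨qf, hqf, h2⟩, h3, h4⟩ := h
  refine ⟨fun n => Nat.casesOn n q r, fun n => Nat.casesOn n u us, fun n => Nat.casesOn n v vs,
    rfl, ?_, ⟨qf, hqf, ?_⟩, joinsTo_cons _ _ _ _ hu h3, joinsTo_cons _ _ _ _ hv h4⟩
  · intro n
    cases n with
    | zero =>
      have h0' : r 0 = q' := h0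
      change Tr z q u v (r 0)
      rw [h0']
      exact ht
    | succ n => exact h1 n
  · intro n
    obtain ⟨m, hm, hq⟩ := h2 n
    exact ⟨m + 1, by omega, hq⟩

theorem acc_inv {σ : Type} [Fintype σ] (z : σ) (x y : ℕ → Option σ)
    (Inv : St → ℕ → ℕ → Prop) (h0 : Inv .start 0 0)
    (hs : ∀ q u v q' i j, Tr z q u v q' → Mt u x i → Mt v y j → Inv q i j →
      Inv q' (i + u.length) (j + v.length))
    (h : (aut z .start).Accepts x y) : ∃ i j, Inv .top i j := by
  obtain ⟨r, us, vs, hr, h1, ⟨qf, hqf, h2⟩, h3, h4⟩ := h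
  rw [joinsTo_iff] at h3 h4
  have key : ∀ n, Inv (r n) (cat us n).length (cat vs n).length := by
    intro n
    induction n with
    | zero =>
      have hr' : r 0 = St.start := hr
      rw [hr']
      simpa [cat] using h0
    | succ n ih =>
      have hx := h3.2 (n + 1)
      have hy := h4.2 (n + 1)
      rw [cat_succ, mt_append] at hx hy
      have := hs _ _ _ _ _ _ (h1 n) hx.2 hy.2 (by simpa using ih)
      rw [cat_succ, cat_succ]
      simpa using this
  obtain ⟨m, -, hm⟩ := h2 0
  have hqf' : qf = St.top := hqf
  have := key m
  rw [hm, hqf'] at this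
  exact ⟨_, _, this⟩

/-- Pairs of positions reachable in state `c1`. -/
inductive R1 {σ : Type} (z : σ) (x y : ℕ → Option σ) : ℕ → ℕ → Prop
  | base : R1 z x y 1 1
  | zz (i j) : R1 z x y i j → x i = some z → y j = some z → R1 z x y (i + 1) (j + 1)
  | blk (i j) : R1 z x y i j → x i ≠ none → x (i + 1) = none → y j = none →
      R1 z x y (i + 2) (j + 1)

/-- Pairs of positions reachable in state `c2`. -/
inductive R2 {σ : Type} (z : σ) (x y : ℕ → Option σ) : ℕ → ℕ → Prop
  | base : R2 z x y 5 1
  | zz (i j) : R2 z x y i j → x i = some z → y j = some z → R2 z x y (i + 1) (j + 1)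
  | blk (i j) : R2 z x y i j → x i ≠ none → x (i + 1) = none → x (i + 2) = some z →
      y j = none → R2 z x y (i + 3) (j + 1)

def NoErr {σ : Type} (z : σ) (x y : ℕ → Option σ) : Prop :=
  Good0 z (x 0) (x 1) (x 2) (x 3) (x 4) (y 0) ∧
  (∀ i j, R1 z x y i j → Good1 z (x i) (x (i + 1)) (y j)) ∧
  (∀ i j, R2 z x y i j → Good2 z (x i) (x (i + 1)) (x (i + 2)) (y j))

theorem not_acc {σ : Type} [Fintype σ] (z : σ) (x y : ℕ → Option σ) (h : NoErr z x y) :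
    ¬ (aut z .start).Accepts x y := by
  intro ha
  obtain ⟨i, j, hij⟩ := acc_inv z x y
    (fun q i j => match q with
      | .start => i = 0 ∧ j = 0
      | .c1 => R1 z x y i j
      | .c2 => R2 z x y i j
      | .top => False) ⟨rfl, rfl⟩ (by
      intro q u v q' i j ht hu hv hi
      cases ht <;> simp only [Mt, List.length_cons, List.length_nil, and_true, zero_add,
        add_assoc, Nat.reduceAdd] at hu hv hi ⊢
      · obtain ⟨rfl, rfl⟩ := hi
        exact R1.base
      · obtain ⟨rfl, rfl⟩ := hi
        exact R2.base
      · obtain ⟨rfl, rfl⟩ := hi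
        rename_i hg
        obtain ⟨rfl, rfl, rfl, rfl, rfl⟩ := hu
        subst hv
        exact hg h.1
      · exact R1.zz _ _ hi hu.symm hv.symm
      · rename_i a ha
        exact R1.blk _ _ hi (hu.1 ▸ ha) hu.2.symm hv.symm
      · rename_i hg
        obtain ⟨rfl, rfl⟩ := hu
        subst hv
        exact hg (h.2.1 _ _ hi)
      · exact R2.zz _ _ hi hu.symm hv.symm
      · rename_i a ha
        exact R2.blk _ _ hi (hu.1 ▸ ha) hu.2.1.symm hu.2.2.symm hv.symm
      · rename_i hg
        obtain ⟨rfl, rfl, rfl⟩ := hu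
        subst hv
        exact hg (h.2.2 _ _ hi)) ha
  exact hij

theorem acc_start_iff {σ : Type} [Fintype σ] (z : σ) (x y : ℕ → Option σ)
    (h : (aut z .start).Accepts (fun k => x (0 + k)) (fun k => y (0 + k))) :
    (aut z .start).Accepts x y := by
  simpa using h

theorem acc_of_err {σ : Type} [Fintype σ] (z : σ) (x y : ℕ → Option σ) (h : ¬ NoErr z x y) :
    (aut z .start).Accepts x y := by
  by_cases h0 : Good0 z (x 0) (x 1) (x 2) (x 3) (x 4) (y 0)
  swap
  · apply acc_start_iff
    exact acc_step z x y (Tr.i3 _ _ _ _ _ _ h0) (i := 0) (j := 0) (by simp [Mt]) (by simp [Mt])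
      (acc_top _ _ _)
  have g := h0
  obtain ⟨ga, gb, gc, gd, ge, gf⟩ := g
  by_cases h1 : ∀ i j, R1 z x y i j → Good1 z (x i) (x (i + 1)) (y j)
  swap
  · push Not at h1
    obtain ⟨i, j, hr, hg⟩ := h1
    have ha : (aut z .c1).Accepts (fun k => x (i + k)) (fun k => y (j + k)) :=
      acc_step z x y (Tr.e1 _ _ _ hg) (by simp [Mt]) (by simp [Mt]) (acc_top _ _ _)
    clear hg
    induction hr with
    | base =>
      exact acc_start_iff _ _ _ (acc_step z x y Tr.i1 (by simp [Mt, ga]) (by simp [Mt, gf]) ha)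
    | zz i j _ hx hy ih =>
      exact ih (acc_step z x y Tr.z1 (by simp [Mt, hx]) (by simp [Mt, hy]) ha)
    | blk i j _ hx hx1 hy ih =>
      exact ih (acc_step z x y (Tr.b1 _ hx) (by simp [Mt, hx1]) (by simp [Mt, hy]) ha)
  by_cases h2 : ∀ i j, R2 z x y i j → Good2 z (x i) (x (i + 1)) (x (i + 2)) (y j)
  swap
  · push Not at h2
    obtain ⟨i, j, hr, hg⟩ := h2
    have ha : (aut z .c2).Accepts (fun k => x (i + k)) (fun k => y (j + k)) :=
      acc_step z x y (Tr.e2 _ _ _ _ hg) (by simp [Mt]) (by simp [Mt]) (acc_top _ _ _)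
    clear hg
    induction hr with
    | base =>
      exact acc_start_iff _ _ _ (acc_step z x y (Tr.i2 _ gc) (by simp [Mt, ga, gb, gd, ge])
        (by simp [Mt, gf]) ha)
    | zz i j _ hx hy ih =>
      exact ih (acc_step z x y Tr.z2 (by simp [Mt, hx]) (by simp [Mt, hy]) ha)
    | blk i j _ hx hx1 hx2 hy ih =>
      exact ih (acc_step z x y (Tr.b2 _ hx) (by simp [Mt, hx1, hx2]) (by simp [Mt, hy]) ha)
  exact absurd ⟨h0, h1, h2⟩ h

/-- Position of the `n`-th block in `h(x)`. -/
def hp : ℕ → ℕ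
  | 0 => 0
  | n + 1 => hp n + (n + 3)

/-- Position of the `n`-th block in `α₀`. -/
def ap : ℕ → ℕ
  | 0 => 0
  | n + 1 => ap n + (n + 2)

theorem hp_decomp (i : ℕ) : ∃ n k, k < n + 3 ∧ i = hp n + k := by
  induction i with
  | zero => exact ⟨0, 0, by omega, rfl⟩
  | succ i ih =>
    obtain ⟨n, k, hk, rfl⟩ := ih
    by_cases h : k + 1 < n + 3
    · exact ⟨n, k + 1, h, rfl⟩
    · exact ⟨n + 1, 0, by omega, by simp only [hp]; omega⟩

theorem ap_decomp (i : ℕ) : ∃ n k, k < n + 2 ∧ i = ap n + k := by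
  induction i with
  | zero => exact ⟨0, 0, by omega, rfl⟩
  | succ i ih =>
    obtain ⟨n, k, hk, rfl⟩ := ih
    by_cases h : k + 1 < n + 2
    · exact ⟨n, k + 1, h, rfl⟩
    · exact ⟨n + 1, 0, by omega, by simp only [ap]; omega⟩

theorem hmap_hp {σ : Type} (z : σ) (w : ℕ → σ) (n i : ℕ) :
    hmap z w (hp n + i) = hAux z w n i := by
  induction n generalizing i with
  | zero => simp [hp, hmap]
  | succ n ih =>
    rw [hp, add_assoc, ih, show n + 3 + i = (n + 2 + i) + 1 by omega, hAux]
    rw [if_neg (by omega)]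
    by_cases h : i = 0
    · subst h
      rw [if_neg (by omega)]
      congr 1
      omega
    · rw [if_neg (by omega)]
      congr 1
      omega

theorem alpha_ap {σ : Type} (z : σ) (n i : ℕ) :
    alphaWord z (ap n + i) = aAux z n i := by
  induction n generalizing i with
  | zero => simp [ap, alphaWord]
  | succ n ih =>
    rw [ap, add_assoc, ih, show n + 2 + i = (n + 1 + i) + 1 by omega, aAux]
    rw [if_neg (by omega)]
    congr 1
    omega

/-- Block form of the pair. -/
def XBlk {σ : Type} (z : σ) (x : ℕ → Option σ) (n : ℕ) : Prop :=
  x (hp n) = none ∧ (∀ k < n + 1, x (hp n + 1 + k) = some z) ∧ x (hp n + n + 2) ≠ none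

def YBlk {σ : Type} (z : σ) (y : ℕ → Option σ) (n : ℕ) : Prop :=
  y (ap n) = none ∧ (∀ k < n + 1, y (ap n + 1 + k) = some z)

theorem range_iff {σ : Type} (z : σ) (x : ℕ → Option σ) :
    x ∈ Set.range (hmap z) ↔ ∀ n, XBlk z x n := by
  constructor
  · rintro ⟨w, rfl⟩ n
    refine ⟨?_, fun k hk => ?_, ?_⟩
    · have := hmap_hp z w n 0
      rw [hAux] at this
      exact this
    · rw [show hp n + 1 + k = hp n + (k + 1) by omega, hmap_hp, hAux, if_pos (by omega)]
    · rw [show hp n + n + 2 = hp n + ((n + 1) + 1) by omega, hmap_hp, hAux, if_neg (by omega),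
        if_pos (by omega)]
      simp
  · intro h
    have hw : ∀ n, ∃ c, x (hp n + n + 2) = some c := fun n => Option.ne_none_iff_exists'.1 (h n).2.2
    choose w hw using hw
    refine ⟨w, funext fun i => ?_⟩
    obtain ⟨n, k, hk, rfl⟩ := hp_decomp i
    rw [hmap_hp]
    cases k with
    | zero => rw [hAux]; exact (h n).1.symm
    | succ k =>
      rw [hAux]
      split_ifs with h1 h2
      · rw [← (h n).2.1 k (by omega)]
        congr 1
        omega
      · rw [← hw n]
        congr 1
        omega
      · omega

theorem alpha_iff {σ : Type} (z : σ) (y : ℕ → Option σ) :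
    y = alphaWord z ↔ ∀ n, YBlk z y n := by
  constructor
  · rintro rfl n
    refine ⟨?_, fun k hk => ?_⟩
    · have := alpha_ap z n 0
      rw [aAux] at this
      exact this
    · rw [show ap n + 1 + k = ap n + (k + 1) by omega, alpha_ap, aAux, if_pos (by omega)]
  · intro h
    refine funext fun i => ?_
    obtain ⟨n, k, hk, rfl⟩ := ap_decomp i
    rw [alpha_ap]
    cases k with
    | zero => rw [aAux]; exact (h n).1
    | succ k =>
      rw [aAux]
      split_ifs with h1
      · rw [← (h n).2 k (by omega)]
        congr 1
        omega
      · omega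

theorem noErr_of_blk {σ : Type} (z : σ) (x y : ℕ → Option σ) (hx : ∀ n, XBlk z x n)
    (hy : ∀ n, YBlk z y n) : NoErr z x y := by
  have X0 : ∀ n i, i = hp n → x i = none := by
    rintro n i rfl; exact (hx n).1
  have X1 : ∀ n k i, k < n + 1 → i = hp n + 1 + k → x i = some z := by
    rintro n k i hk rfl; exact (hx n).2.1 k hk
  have X2 : ∀ n i, i = hp n + n + 2 → x i ≠ none := by
    rintro n i rfl; exact (hx n).2.2
  have Y0 : ∀ n i, i = ap n → y i = none := by
    rintro n i rfl; exact (hy n).1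
  have Y1 : ∀ n k i, k < n + 1 → i = ap n + 1 + k → y i = some z := by
    rintro n k i hk rfl; exact (hy n).2 k hk
  have hps : ∀ n, hp (n + 1) = hp n + (n + 3) := fun n => rfl
  have aps : ∀ n, ap (n + 1) = ap n + (n + 2) := fun n => rfl
  have hp0 : hp 0 = 0 := rfl
  have ap0 : ap 0 = 0 := rfl
  have hp1 : hp 1 = 3 := rfl
  refine ⟨⟨X0 0 0 rfl, X1 0 0 1 (by omega) (by omega), X2 0 2 (by omega), X0 1 3 rfl,
    X1 1 0 4 (by omega) (by omega), Y0 0 0 rfl⟩, ?_, ?_⟩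
  · intro i j hr
    have key : ∃ n k, k ≤ n + 1 ∧ i = hp n + 1 + k ∧ j = ap n + 1 + k := by
      induction hr with
      | base => exact ⟨0, 0, by omega, by omega, by omega⟩
      | zz i j _ h1 h2 ih =>
        obtain ⟨n, k, hk, hi, hj⟩ := ih
        have : k ≠ n + 1 := by
          rintro rfl
          rw [Y0 (n + 1) j (by have := aps n; omega)] at h2
          cases h2
        exact ⟨n, k + 1, by omega, by omega, by omega⟩
      | blk i j _ h1 h2 h3 ih =>
        obtain ⟨n, k, hk, hi, hj⟩ := ih
        have : k = n + 1 := by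
          by_contra hne
          rw [Y1 n k j (by omega) hj] at h3
          cases h3
        refine ⟨n + 1, 0, by omega, ?_, ?_⟩
        · have := hps n; omega
        · have := aps n; omega
    obtain ⟨n, k, hk, hi, hj⟩ := key
    have := hps n
    have := aps n
    by_cases hkn : k = n + 1
    · exact Or.inr ⟨Y0 (n + 1) j (by omega), X2 n i (by omega), X0 (n + 1) _ (by omega)⟩
    · exact Or.inl ⟨Y1 n k j (by omega) hj, X1 n k i (by omega) hi⟩
  · intro i j hr
    have key : ∃ n k, k ≤ n + 1 ∧ i = hp (n + 1) + 2 + k ∧ j = ap n + 1 + k := by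
      induction hr with
      | base => exact ⟨0, 0, by omega, by simp [hp], by omega⟩
      | zz i j _ h1 h2 ih =>
        obtain ⟨n, k, hk, hi, hj⟩ := ih
        have : k ≠ n + 1 := by
          rintro rfl
          rw [Y0 (n + 1) j (by have := aps n; omega)] at h2
          cases h2
        exact ⟨n, k + 1, by omega, by omega, by omega⟩
      | blk i j _ h1 h2 h3 h4 ih =>
        obtain ⟨n, k, hk, hi, hj⟩ := ih
        have : k = n + 1 := by
          by_contra hne
          rw [Y1 n k j (by omega) hj] at h4
          cases h4
        refine ⟨n + 1, 0, by omega, ?_, ?_⟩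
        · have := hps (n + 1); omega
        · have := aps n; omega
    obtain ⟨n, k, hk, hi, hj⟩ := key
    have : hp (n + 2) = hp (n + 1) + (n + 1 + 3) := hps (n + 1)
    have := aps n
    by_cases hkn : k = n + 1
    · exact Or.inr ⟨Y0 (n + 1) j (by omega), X2 (n + 1) i (by omega), X0 (n + 2) _ (by omega),
        X1 (n + 2) 0 _ (by omega) (by omega)⟩
    · exact Or.inl ⟨Y1 n k j (by omega) hj, X1 (n + 1) (k + 1) i (by omega) (by omega)⟩

theorem blk_of_noErr {σ : Type} (z : σ) (x y : ℕ → Option σ) (h : NoErr z x y) (n : ℕ) :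
    XBlk z x n ∧ YBlk z y n ∧ R1 z x y (hp n + 1) (ap n + 1) ∧
      R2 z x y (hp (n + 1) + 2) (ap n + 1) ∧ x (hp (n + 1)) = none ∧
      x (hp (n + 1) + 1) = some z ∧ y (ap (n + 1)) = none := by
  obtain ⟨⟨ga, gb, gc, gd, ge, gf⟩, H1, H2⟩ := h
  have hps : ∀ n, hp (n + 1) = hp n + (n + 3) := fun n => rfl
  have aps : ∀ n, ap (n + 1) = ap n + (n + 2) := fun n => rfl
  -- the second tape follows the first
  have stepY : ∀ n, XBlk z x n → y (ap n) = none → R1 z x y (hp n + 1) (ap n + 1) →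
      x (hp (n + 1)) = none →
      YBlk z y n ∧ y (ap (n + 1)) = none ∧ R1 z x y (hp (n + 1) + 1) (ap (n + 1) + 1) := by
    intro n hX hy hr hx1
    have A : ∀ k ≤ n + 1, R1 z x y (hp n + 1 + k) (ap n + 1 + k) ∧
        ∀ l < k, y (ap n + 1 + l) = some z := by
      intro k
      induction k with
      | zero => intro _; exact ⟨hr, by simp⟩
      | succ k ih =>
        intro hk
        obtain ⟨ih1, ih2⟩ := ih (by omega)
        have hxk := hX.2.1 k (by omega)
        have hyk : y (ap n + 1 + k) = some z := by
          rcases H1 _ _ ih1 with ⟨g, _⟩ | ⟨_, _, g⟩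
          · exact g
          · exfalso
            by_cases hkn : k = n
            · subst hkn
              apply hX.2.2
              rw [← g]; congr 1; omega
            · have := hX.2.1 (k + 1) (by omega)
              rw [show hp n + 1 + (k + 1) = hp n + 1 + k + 1 by omega, g] at this
              cases this
        refine ⟨R1.zz _ _ ih1 hxk hyk, fun l hl => ?_⟩
        by_cases hlk : l = k
        · subst hlk; exact hyk
        · exact ih2 l (by omega)
    obtain ⟨A1, A2⟩ := A (n + 1) le_rfl
    have e1 : hp n + 1 + (n + 1) + 1 = hp (n + 1) := by rw [hps]; omega
    have e2 : ap n + 1 + (n + 1) = ap (n + 1) := by rw [aps]; omega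
    have e3 : hp n + 1 + (n + 1) = hp n + n + 2 := by omega
    have hyn : y (ap n + 1 + (n + 1)) = none := by
      rcases H1 _ _ A1 with ⟨g1, g2⟩ | ⟨g, _⟩
      · exfalso
        have := H1 _ _ (R1.zz _ _ A1 g2 g1)
        rw [e1, hx1] at this
        simp [Good1] at this
      · exact g
    refine ⟨⟨hy, A2⟩, e2 ▸ hyn, ?_⟩
    have := R1.blk _ _ A1 (e3 ▸ hX.2.2) (by rw [e1, hx1]) hyn
    rw [e2, show hp n + 1 + (n + 1) + 2 = hp (n + 1) + 1 by rw [← e1]] at this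
    exact this
  have stepX : ∀ n, YBlk z y n → y (ap (n + 1)) = none →
      R2 z x y (hp (n + 1) + 2) (ap n + 1) → x (hp (n + 1)) = none →
      x (hp (n + 1) + 1) = some z →
      XBlk z x (n + 1) ∧ x (hp (n + 2)) = none ∧ x (hp (n + 2) + 1) = some z ∧
      R2 z x y (hp (n + 2) + 2) (ap (n + 1) + 1) := by
    intro n hY hy hr hx0 hx1
    have A : ∀ k ≤ n + 1, R2 z x y (hp (n + 1) + 2 + k) (ap n + 1 + k) ∧
        ∀ l < k, x (hp (n + 1) + 2 + l) = some z := by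
      intro k
      induction k with
      | zero => intro _; exact ⟨hr, by simp⟩
      | succ k ih =>
        intro hk
        obtain ⟨ih1, ih2⟩ := ih (by omega)
        have hyk := hY.2 k (by omega)
        have hxk : x (hp (n + 1) + 2 + k) = some z := by
          rcases H2 _ _ ih1 with ⟨_, g⟩ | ⟨g, _⟩
          · exact g
          · rw [hyk] at g
            cases g
        refine ⟨R2.zz _ _ ih1 hxk hyk, fun l hl => ?_⟩
        by_cases hlk : l = k
        · subst hlk; exact hxk
        · exact ih2 l (by omega)
    obtain ⟨A1, A2⟩ := A (n + 1) le_rfl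
    have e2 : ap n + 1 + (n + 1) = ap (n + 1) := by rw [aps]; omega
    have e1 : hp (n + 1) + 2 + (n + 1) + 1 = hp (n + 2) := by rw [hps (n + 1)]; omega
    have e3 : hp (n + 1) + 2 + (n + 1) = hp (n + 1) + (n + 1) + 2 := by omega
    have e4 : hp (n + 1) + 2 + (n + 1) + 2 = hp (n + 2) + 1 := by omega
    have e5 : hp (n + 1) + 2 + (n + 1) + 3 = hp (n + 2) + 2 := by omega
    have hyn : y (ap n + 1 + (n + 1)) = none := by rw [e2]; exact hy
    rcases H2 _ _ A1 with ⟨g, _⟩ | ⟨_, g1, g2, g3⟩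
    · rw [hyn] at g
      cases g
    have hr' := R2.blk _ _ A1 g1 g2 g3 hyn
    rw [e5, e2] at hr'
    rw [e1] at g2
    rw [e4] at g3
    rw [e3] at g1
    refine ⟨⟨hx0, fun k hk => ?_, g1⟩, g2, g3, hr'⟩
    cases k with
    | zero => exact hx1
    | succ k =>
      have := A2 k (by omega)
      rw [← this]; congr 1; omega
  induction n with
  | zero =>
    have hX : XBlk z x 0 := by
      refine ⟨ga, fun k hk => ?_, gc⟩
      have : k = 0 := by omega
      subst this
      exact gb
    obtain ⟨s1, s2, s3⟩ := stepY 0 hX gf R1.base gd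
    exact ⟨hX, s1, R1.base, R2.base, gd, ge, s2⟩
  | succ n ih =>
    obtain ⟨i1, i2, i3, i4, i5, i6, i7⟩ := ih
    obtain ⟨-, -, r1⟩ := stepY n i1 i2.1 i3 i5
    obtain ⟨t1, t2, t3, t4⟩ := stepX n i2 i7 i4 i5 i6
    obtain ⟨s1, s2, s3⟩ := stepY (n + 1) t1 i7 r1 t2
    exact ⟨t1, s1, r1, t4, t2, t3, s2⟩

end RatProof

/-- The set `R₂ = (Γ^ω × Γ^ω) − (h(Σ^ω) × {α₀})` is an infinitary
rational relation. -/
theorem isRatRel_compl_graph (σ : Type) [Fintype σ] [Nonempty σ] (z : σ) :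
    IsRatRel ((Set.range (hmap z) ×ˢ ({alphaWord z} : Set (ℕ → Option σ)))ᶜ) := by
  refine ⟨RatProof.aut z .start, fun p => ?_⟩
  have e : p ∈ (Set.range (hmap z) ×ˢ ({alphaWord z} : Set (ℕ → Option σ))) ↔
      RatProof.NoErr z p.1 p.2 := by
    rw [Set.mem_prod, Set.mem_singleton_iff, RatProof.range_iff, RatProof.alpha_iff]
    exact ⟨fun h => RatProof.noErr_of_blk z _ _ h.1 h.2,
      fun h => ⟨fun n => (RatProof.blk_of_noErr z _ _ h n).1,
        fun n => (RatProof.blk_of_noErr z _ _ h n).2.1⟩⟩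
  rw [Set.mem_compl_iff, e]
  exact ⟨RatProof.acc_of_err z _ _, fun ha hn => RatProof.not_acc z _ _ hn ha⟩
end
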